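/- There is an absolute constant C > 0 such that for all integers m ≥ 2 and all integers d with 1 ≤ d ≤ m/2, the number of m × m sign matrices of sign-rank at most d is at most (C·m/d)^{2dm}. -/

import Mathlib

open scoped BigOperators

/-- The sign-rank of a sign matrix `F`: the smallest rank of a real matrix `M` with
`F x y * M x y > 0` for all entries. -/
noncomputable def signRank {X Y : Type*} [Fintype X] [Fintype Y] (F : Matrix X Y ℝ) : ℕ :=
  sInf {r : ℕ | ∃ M : Matrix X Y ℝ, (∀ x y, 0 < F x y * M x y) ∧ M.rank ≤ r}

section

open MvPolynomial

theorem hasFDerivAt_eval_mvPolynomial {ι : Type*} [Fintype ι]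
    (p : MvPolynomial ι ℝ) (x : ι → ℝ) :
    HasFDerivAt (fun y : ι → ℝ => eval y p)
      (∑ j, eval x (pderiv j p) • (ContinuousLinearMap.proj j : (ι → ℝ) →L[ℝ] ℝ)) x := by
  classical
  induction p using MvPolynomial.induction_on with
  | C a => simpa using hasFDerivAt_const a x
  | add p q hp hq =>
    simp only [map_add, add_smul, Finset.sum_add_distrib]
    exact hp.add hq
  | mul_X p i hp =>
    have hX : HasFDerivAt (fun y : ι → ℝ => y i)
      (ContinuousLinearMap.proj i : (ι → ℝ) →L[ℝ] ℝ) x := hasFDerivAt_apply i x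
    simp only [map_mul, eval_X]
    refine (hp.mul hX).congr_fderiv ?_
    ext v
    simp [Derivation.leibniz, pderiv_X, add_mul, Finset.sum_add_distrib, Finset.mul_sum,
      Pi.single_apply, apply_ite, mul_assoc]

theorem totalDegree_pderiv_le {ι : Type*} {p : MvPolynomial ι ℝ} {k : ℕ}
    (hp : p.totalDegree ≤ k + 1) (i : ι) : (pderiv i p).totalDegree ≤ k := by
  rw [totalDegree, Finset.sup_le_iff]
  intro m hm
  rw [mem_support_iff, coeff_pderiv] at hm
  have h := (le_totalDegree (mem_support_iff.2 (left_ne_zero_of_mul hm))).trans hp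
  change (m + Finsupp.single i 1).degree ≤ _ at h
  change m.degree ≤ k
  rw [Finsupp.degree.map_add, Finsupp.degree_single] at h
  omega

theorem finite_degree_le (ι : Type*) [Finite ι] (N : ℕ) :
    Finite {a : ι →₀ ℕ // a.degree ≤ N} :=
  ((Set.Finite.pi' fun _ => Set.finite_le_nat N).preimage DFunLike.coe_injective.injOn).subset
    fun a ha i => (Finsupp.le_degree i a).trans ha

theorem finrank_restrictTotalDegree (ι : Type*) [Finite ι] (N : ℕ) :
    Module.finrank ℝ (restrictTotalDegree ι ℝ N) = Nat.card {a : ι →₀ ℕ // a.degree ≤ N} :=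
  Module.finrank_eq_nat_card_basis (basisRestrictSupport ℝ {a : ι →₀ ℕ | a.degree ≤ N})

theorem card_degree_le_le_pow_mul (ι : Type*) [Fintype ι] (M T : ℕ) (hM : 0 < M) :
    Nat.card {a : ι →₀ ℕ // a.degree ≤ M * T + (M - 1)} ≤
      M ^ Fintype.card ι * Nat.card {a : ι →₀ ℕ // a.degree ≤ T} := by
  have := finite_degree_le ι T
  let φ : {a : ι →₀ ℕ // a.degree ≤ M * T + (M - 1)} →
      (ι → Fin M) × {a : ι →₀ ℕ // a.degree ≤ T} := fun a =>
    (fun i => ⟨a.1 i % M, Nat.mod_lt _ hM⟩, ⟨Finsupp.equivFunOnFinite.symm fun i => a.1 i / M, by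
      have h := a.2
      rw [Finsupp.degree_eq_sum] at h ⊢
      have h1 : M * ∑ i, a.1 i / M ≤ ∑ i, a.1 i := by
        rw [Finset.mul_sum]
        exact Finset.sum_le_sum fun i _ => Nat.mul_div_le _ _
      simp only [Finsupp.equivFunOnFinite_symm_apply_apply]
      by_contra! hc
      have h2 : M * (T + 1) ≤ M * ∑ i, a.1 i / M := Nat.mul_le_mul_left _ hc
      rw [Nat.mul_add] at h2
      omega⟩)
  have hφ : Function.Injective φ := by
    intro a b hab
    ext i
    have h1 := congrArg (fun z => ((z.1 i : Fin M) : ℕ)) hab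
    have h2 := congrArg (fun z => (z.2.1 : ι →₀ ℕ) i) hab
    simp only [φ, Finsupp.equivFunOnFinite_symm_apply_apply] at h1 h2
    rw [← Nat.div_add_mod (a.1 i) M, ← Nat.div_add_mod (b.1 i) M, h1, h2]
  calc _ ≤ Nat.card ((ι → Fin M) × {a : ι →₀ ℕ // a.degree ≤ T}) :=
        Nat.card_le_card_of_injective φ hφ
    _ = _ := by rw [Nat.card_prod, Nat.card_fun, Nat.card_fin, Nat.card_eq_fintype_card]

/-- Polynomials separating the points of a finite set. -/
theorem exists_eval_eq_ite {ι : Type*} (Z : Finset (ι → ℝ)) (z : ι → ℝ) :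
    ∃ g : MvPolynomial ι ℝ, eval z g = 1 ∧ ∀ w ∈ Z, w ≠ z → eval w g = 0 := by
  classical
  have h : ∀ w : ι → ℝ, ∃ g : MvPolynomial ι ℝ, eval z g = 1 ∧ (w ≠ z → eval w g = 0) := by
    intro w
    by_cases hw : w = z
    · exact ⟨1, by simp [hw]⟩
    · obtain ⟨i, hi⟩ := Function.ne_iff.1 hw
      refine ⟨C (z i - w i)⁻¹ * (X i - C (w i)), ?_, fun _ => by simp⟩
      simp [inv_mul_cancel₀ (sub_ne_zero.2 (Ne.symm hi))]
  choose g hg hg' using h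
  refine ⟨∏ w ∈ Z, g w, by simp [map_prod, hg], fun w hw hne => ?_⟩
  rw [map_prod]
  exact Finset.prod_eq_zero hw (hg' w hne)

open Filter Topology in
theorem tendsto_inv_mul_eval_add_smul {ι : Type*} [Fintype ι] {p : MvPolynomial ι ℝ}
    {z : ι → ℝ} (hz : eval z p = 0) (v : ι → ℝ) :
    Tendsto (fun ε : ℝ => ε⁻¹ * eval (z + ε • v) p) (𝓝[≠] 0)
      (𝓝 (∑ j, eval z (pderiv j p) * v j)) := by
  have h := ((hasFDerivAt_eval_mvPolynomial p z).hasLineDerivAt v).tendsto_slope_zero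
  simpa [hz] using h

open Filter Topology in
theorem coeff_eq_zero_of_sum_prod_pow_mul_eq_zero {ι : Type*} [Fintype ι] [DecidableEq ι]
    {Ψ : ι → MvPolynomial ι ℝ} {Z : Finset (ι → ℝ)}
    (hZ : ∀ z ∈ Z, ∀ i, eval z (Ψ i) = 0)
    (hJ : ∀ z ∈ Z, (Matrix.of fun i j => eval z (pderiv j (Ψ i))).det ≠ 0)
    {g : (ι → ℝ) → MvPolynomial ι ℝ} (hg : ∀ z, eval z (g z) = 1)
    (hg' : ∀ z, ∀ w ∈ Z, w ≠ z → eval w (g z) = 0)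
    (A : Finset (ι →₀ ℕ)) (c : (ι →₀ ℕ) → (ι → ℝ) → ℝ)
    (h : ∑ a ∈ A, ∑ z ∈ Z, c a z • ((∏ i, Ψ i ^ a i) * g z) = 0) :
    ∀ a ∈ A, ∀ z ∈ Z, c a z = 0 := by
  suffices H : ∀ s : ℕ, ∀ a ∈ A, a.degree = s → ∀ z ∈ Z, c a z = 0 from
    fun a ha => H _ a ha rfl
  intro s
  induction s using Nat.strong_induction_on with
  | _ s ih =>
  intro a ha has z hz
  set Q : MvPolynomial ι ℝ := ∑ a ∈ A with a.degree = s, monomial a (c a z) with hQ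
  have hQ0 : Q = 0 := by
    apply MvPolynomial.funext
    intro w
    set J : Matrix ι ι ℝ := Matrix.of fun i j => eval z (pderiv j (Ψ i)) with hJdef
    obtain ⟨v, hv⟩ : ∃ v, J.mulVec v = w :=
      ⟨J⁻¹.mulVec w, by
        rw [Matrix.mulVec_mulVec, Matrix.mul_nonsing_inv _ (hJ z hz).isUnit, Matrix.one_mulVec]⟩
    have hΨ : ∀ i, Tendsto (fun ε : ℝ => ε⁻¹ * eval (z + ε • v) (Ψ i)) (𝓝[≠] 0) (𝓝 (w i)) := by
      intro i
      have := tendsto_inv_mul_eval_add_smul (hZ z hz i) v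
      rwa [show ∑ j, eval z (pderiv j (Ψ i)) * v j = w i by rw [← hv]; rfl] at this
    have hgt : ∀ y, Tendsto (fun ε : ℝ => eval (z + ε • v) (g y)) (𝓝[≠] 0)
        (𝓝 (eval z (g y))) := by
      intro y
      have hc : Continuous fun ε : ℝ => eval (z + ε • v) (g y) :=
        (MvPolynomial.continuous_eval (g y)).comp (by fun_prop)
      simpa using (hc.tendsto 0).mono_left nhdsWithin_le_nhds
    have hid : Tendsto (fun ε : ℝ => ε) (𝓝[≠] 0) (𝓝 0) := nhdsWithin_le_nhds
    have hterm : ∀ b ∈ A, ∀ y ∈ Z, Tendsto (fun ε : ℝ => ε⁻¹ ^ s *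
        eval (z + ε • v) (c b y • ((∏ i, Ψ i ^ b i) * g y))) (𝓝[≠] 0)
        (𝓝 (if b.degree = s then c b y * ((∏ i, w i ^ b i) * eval z (g y)) else 0)) := by
      intro b hb y hy
      rcases lt_or_ge b.degree s with hlt | hge
      · simp [ih _ hlt b hb rfl y hy, hlt.ne]
      · obtain ⟨r, hr⟩ := Nat.exists_eq_add_of_le hge
        have hlim := ((hid.pow r).mul ((tendsto_finsetProd Finset.univ
          fun i _ => (hΨ i).pow (b i)).mul (hgt y))).const_mul (c b y)
        have heq : (fun ε : ℝ => ε⁻¹ ^ s *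
            eval (z + ε • v) (c b y • ((∏ i, Ψ i ^ b i) * g y))) =ᶠ[𝓝[≠] 0]
            fun ε => c b y * (ε ^ r * ((∏ i, (ε⁻¹ * eval (z + ε • v) (Ψ i)) ^ b i) *
              eval (z + ε • v) (g y))) := by
          filter_upwards [self_mem_nhdsWithin] with ε hε
          have hε : ε ≠ 0 := hε
          have hb : ∏ i, ε⁻¹ ^ b i = ε⁻¹ ^ s * ε⁻¹ ^ r := by
            rw [Finset.prod_pow_eq_pow_sum, ← pow_add, ← hr, Finsupp.degree_eq_sum]
          simp only [smul_eval, map_mul, map_prod, map_pow, mul_pow, Finset.prod_mul_distrib, hb]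
          have : ε ^ r * ε⁻¹ ^ r = 1 := by rw [← mul_pow, mul_inv_cancel₀ hε, one_pow]
          linear_combination (-(c b y * ε⁻¹ ^ s * (∏ i, eval (z + ε • v) (Ψ i) ^ b i) *
            eval (z + ε • v) (g y))) * this
        refine Tendsto.congr' heq.symm ?_
        convert hlim using 2
        split_ifs with hs
        · have : r = 0 := by omega
          simp [this]
        · have : r ≠ 0 := by omega
          simp [this]
    have hsum := tendsto_finsetSum A fun b hb => tendsto_finsetSum Z fun y hy => hterm b hb y hy
    have hzero : (fun ε : ℝ => ∑ b ∈ A, ∑ y ∈ Z, ε⁻¹ ^ s *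
        eval (z + ε • v) (c b y • ((∏ i, Ψ i ^ b i) * g y))) = fun _ => 0 := by
      funext ε
      simp only [← Finset.mul_sum]
      simp only [← map_sum, h, map_zero, mul_zero]
    rw [hzero] at hsum
    have := tendsto_nhds_unique hsum tendsto_const_nhds
    rw [map_zero, ← this, hQ, map_sum, Finset.sum_filter]
    refine Finset.sum_congr rfl fun b _ => ?_
    rw [Finset.sum_eq_single z]
    · simp [hg, eval_monomial, Finsupp.prod_fintype]
    · intro y hy hne
      simp [hg' y z hz hne.symm]
    · exact fun hn => absurd hz hn
  have := congrArg (coeff a) hQ0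
  rw [hQ, coeff_sum, Finset.sum_eq_single a] at this
  · simpa using this
  · intro b _ hb
    simp [coeff_monomial, hb]
  · intro hn
    exact absurd (Finset.mem_filter.2 ⟨ha, has⟩) hn

/-- A system of `n` polynomial equations of degree at most `e` in `n` real unknowns has at most
`(e + 1) ^ n` nondegenerate solutions. -/
theorem card_nondegenerate_zeros_le {ι : Type*} [Fintype ι] [DecidableEq ι]
    {Ψ : ι → MvPolynomial ι ℝ} {e : ℕ} (he : ∀ i, (Ψ i).totalDegree ≤ e) {Z : Finset (ι → ℝ)}
    (hZ : ∀ z ∈ Z, ∀ i, eval z (Ψ i) = 0)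
    (hJ : ∀ z ∈ Z, (Matrix.of fun i j => eval z (pderiv j (Ψ i))).det ≠ 0) :
    Z.card ≤ (e + 1) ^ Fintype.card ι := by
  choose g hg hg' using exists_eval_eq_ite Z
  set T := Z.sup fun z => (g z).totalDegree with hT
  have hfin := finite_degree_le ι T
  have := Fintype.ofFinite {a : ι →₀ ℕ // a.degree ≤ T}
  have hmem : ∀ x : {a : ι →₀ ℕ // a.degree ≤ T} × Z,
      (∏ i, Ψ i ^ x.1.1 i) * g x.2 ∈ restrictTotalDegree ι ℝ ((e + 1) * T + (e + 1 - 1)) := by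
    rintro ⟨⟨a, ha⟩, ⟨z, hz⟩⟩
    rw [mem_restrictTotalDegree]
    have h1 : (∏ i, Ψ i ^ a i).totalDegree ≤ e * T := by
      calc _ ≤ ∑ i, (Ψ i ^ a i).totalDegree := totalDegree_finsetProd _ _
        _ ≤ ∑ i, e * a i := Finset.sum_le_sum fun i _ => (totalDegree_pow _ _).trans
            (by rw [mul_comm]; exact Nat.mul_le_mul_right _ (he i))
        _ ≤ e * T := by
          rw [← Finset.mul_sum, ← Finsupp.degree_eq_sum]; exact Nat.mul_le_mul_left _ ha
    have h2 : (g z).totalDegree ≤ T := Finset.le_sup (f := fun z => (g z).totalDegree) hz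
    refine (totalDegree_mul _ _).trans ((add_le_add h1 h2).trans ?_)
    rw [add_mul]
    omega
  have hli : LinearIndependent ℝ fun x : {a : ι →₀ ℕ // a.degree ≤ T} × Z =>
      (⟨_, hmem x⟩ : restrictTotalDegree ι ℝ ((e + 1) * T + (e + 1 - 1))) := by
    rw [Fintype.linearIndependent_iff]
    intro c hc
    have hc' := congrArg Subtype.val hc
    simp only [Submodule.coe_sum, Submodule.coe_smul, ZeroMemClass.coe_zero] at hc'
    let c' : (ι →₀ ℕ) → (ι → ℝ) → ℝ := fun a z =>
      if h : a.degree ≤ T ∧ z ∈ Z then c (⟨a, h.1⟩, ⟨z, h.2⟩) else 0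
    have key := coeff_eq_zero_of_sum_prod_pow_mul_eq_zero hZ hJ hg hg'
      (Finset.univ.map (Function.Embedding.subtype fun a : ι →₀ ℕ => a.degree ≤ T)) c' (by
        rw [Finset.sum_map, ← hc', Fintype.sum_prod_type]
        refine Finset.sum_congr rfl fun a _ => ?_
        rw [← Finset.sum_coe_sort Z]
        refine Finset.sum_congr rfl fun z _ => ?_
        have hcz : c' a z = c (a, z) := dif_pos ⟨a.2, z.2⟩
        rw [← hcz]
        rfl)
    rintro ⟨a, z⟩
    have hcz : c' a z = c (a, z) := dif_pos ⟨a.2, z.2⟩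
    rw [← hcz]
    exact key a (by simp) z z.2
  have hcard := hli.fintype_card_le_finrank
  rw [finrank_restrictTotalDegree, Fintype.card_prod, Fintype.card_coe,
    ← Nat.card_eq_fintype_card, mul_comm] at hcard
  have hpos : 0 < Nat.card {a : ι →₀ ℕ // a.degree ≤ T} :=
    Nat.card_pos_iff.2 ⟨⟨⟨0, by simp⟩⟩, hfin⟩
  exact Nat.le_of_mul_le_mul_right
    (hcard.trans (card_degree_le_le_pow_mul ι (e + 1) T e.succ_pos)) hpos

theorem contDiff_eval_mvPolynomial {ι : Type*} [Fintype ι] (p : MvPolynomial ι ℝ) {n : WithTop ℕ∞} :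
    ContDiff ℝ n fun x : ι → ℝ => eval x p := by
  induction p using MvPolynomial.induction_on with
  | C a => simpa using contDiff_const
  | add p q hp hq => simpa using hp.add hq
  | mul_X p i hp => simpa using hp.mul (contDiff_apply ℝ ℝ i)

/-- After subtracting generic constants, no more than `card ι` polynomials in the variables `ι`
have a common zero. -/
theorem dense_setOf_no_common_zero {ι κ : Type*} [Fintype ι] [Fintype κ]
    (f : κ → MvPolynomial ι ℝ) :
    Dense {b : κ → ℝ | ∀ S : Finset κ, Fintype.card ι < S.card →
      ∀ x, ∃ i ∈ S, eval x (f i) ≠ b i} := by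
  classical
  let φ : ∀ S : Finset κ, (ι → ℝ) × ({i // i ∉ S} → ℝ) → κ → ℝ := fun S p i =>
    if h : i ∈ S then eval p.1 (f i) else p.2 ⟨i, h⟩
  have hφ : ∀ S, ContDiff ℝ 1 (φ S) := by
    intro S
    refine contDiff_pi.2 fun i => ?_
    by_cases h : i ∈ S
    · simpa [φ, h, Function.comp_def] using (contDiff_eval_mvPolynomial (f i)).comp contDiff_fst
    · simpa [φ, h, Function.comp_def] using (contDiff_apply ℝ ℝ (⟨i, h⟩ : {i // i ∉ S})).comp contDiff_snd
  rcases isEmpty_or_nonempty κ with hκ | hκ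
  · convert dense_univ
    ext b
    simp only [Set.mem_ofPred_eq, Set.mem_univ, iff_true]
    intro S hS
    simp [Finset.eq_empty_of_isEmpty S] at hS
  have hdim : dimH (⋃ S ∈ {S : Finset κ | Fintype.card ι < S.card}, Set.range (φ S)) <
      Module.finrank ℝ (κ → ℝ) := by
    rw [dimH_bUnion (Set.to_countable _)]
    have hpos : 0 < Fintype.card κ := Fintype.card_pos
    refine lt_of_le_of_lt (b := ((Fintype.card κ - 1 : ℕ) : ENNReal)) (iSup₂_le fun S hS => ?_) ?_
    · refine (hφ S).dimH_range_le.trans ?_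
      have hS : Fintype.card ι < S.card := hS
      have hS' := Finset.card_le_univ S
      simp only [Module.finrank_prod, Module.finrank_fintype_fun_eq_card,
        Fintype.card_subtype_compl, Fintype.card_coe]
      exact_mod_cast (by omega)
    · rw [Module.finrank_fintype_fun_eq_card]
      exact_mod_cast Nat.sub_lt hpos one_pos
  refine (dense_compl_of_dimH_lt_finrank hdim).mono fun b hb S hS x => ?_
  by_contra! hc
  refine hb (Set.mem_biUnion (show S ∈ {S : Finset κ | Fintype.card ι < S.card} from hS)
    ⟨(x, fun i => b i), ?_⟩)
  ext i
  by_cases h : i ∈ S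
  · simp [φ, h, hc i h]
  · simp [φ, h]

/-- Finitely many polynomial maps have a common regular value in the unit ball. -/
theorem exists_common_regular_value {ι α : Type*} [Fintype ι] [DecidableEq ι] [Countable α]
    (Φ : α → ι → MvPolynomial ι ℝ) :
    ∃ c : ι → ℝ, ‖c‖ ≤ 1 ∧ ∀ a z, (∀ i, eval z (Φ a i) = c i) →
      (Matrix.of fun i j => eval z (pderiv j (Φ a i))).det ≠ 0 := by
  let J : α → (ι → ℝ) → Matrix ι ι ℝ := fun a z =>
    Matrix.of fun i j => eval z (pderiv j (Φ a i))
  let F : α → (ι → ℝ) → ι → ℝ := fun a z i => eval z (Φ a i)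
  have hnull : MeasureTheory.volume (⋃ a, F a '' {z | (J a z).det = 0}) = 0 := by
    refine MeasureTheory.measure_iUnion_null fun a => ?_
    refine MeasureTheory.addHaar_image_eq_zero_of_det_fderivWithin_eq_zero _
      (f' := fun z => LinearMap.toContinuousLinearMap (Matrix.toLin' (J a z))) ?_ ?_
    · intro z _
      refine (hasFDerivAt_pi'' fun i => ?_).hasFDerivWithinAt
      refine (hasFDerivAt_eval_mvPolynomial (Φ a i) z).congr_fderiv ?_
      ext v
      simp [J, Matrix.mulVec, dotProduct]
    · intro z hz
      simpa [LinearMap.det_toLin'] using hz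
  have hball : MeasureTheory.volume (Metric.closedBall (0 : ι → ℝ) 1) ≠ 0 :=
    (Metric.measure_closedBall_pos _ _ one_pos).ne'
  obtain ⟨c, hc, hc'⟩ : (Metric.closedBall (0 : ι → ℝ) 1 \
      ⋃ a, F a '' {z | (J a z).det = 0}).Nonempty := by
    refine MeasureTheory.nonempty_of_measure_ne_zero (μ := MeasureTheory.volume) ?_
    rwa [MeasureTheory.measure_sdiff_null hnull]
  refine ⟨c, by simpa using hc, fun a z hz hdet => hc' ?_⟩
  exact Set.mem_iUnion.2 ⟨a, z, hdet, funext hz⟩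

theorem exists_penalized_critical_point {ι κ : Type*} [Fintype ι] [Fintype κ]
    (g : κ → MvPolynomial ι ℝ) {s : κ → ℝ} (hs : ∀ i, s i ^ 2 = 1) {p : ι → ℝ}
    (hp : ∀ i, 0 < s i * eval p (g i)) (c : ι → ℝ) {t : ℝ} (ht : 0 ≤ t) :
    ∃ (q : ι → ℝ) (S : Finset κ), (∀ i, i ∈ S ↔ s i * eval q (g i) ≤ 0) ∧
      ∑ k, (q k - c k) ^ 2 + t * ∑ i ∈ S, eval q (g i) ^ 2 ≤ ∑ k, (p k - c k) ^ 2 ∧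
      ∀ k, eval q (X k + C t * ∑ i ∈ S, g i * pderiv k (g i)) = c k := by
  classical
  let P : (ι → ℝ) → ℝ := fun x =>
    ∑ k, (x k - c k) ^ 2 + t * ∑ i, min (s i * eval x (g i)) 0 ^ 2
  have hPc : Continuous P := by
    have := fun i => MvPolynomial.continuous_eval (g i)
    fun_prop
  have hPp : P p = ∑ k, (p k - c k) ^ 2 := by
    have : ∀ i, min (s i * eval p (g i)) 0 = 0 := fun i => min_eq_right (hp i).le
    simp [P, this]
  have hbdd : Bornology.IsBounded {x | P x ≤ P p} := by
    refine (Metric.isBounded_closedBall (x := c) (r := √(P p))).subset fun x hx => ?_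
    rw [Metric.mem_closedBall, dist_pi_le_iff (Real.sqrt_nonneg _)]
    intro k
    rw [Real.dist_eq]
    refine Real.abs_le_sqrt ?_
    have h1 : (x k - c k) ^ 2 ≤ ∑ k, (x k - c k) ^ 2 :=
      Finset.single_le_sum (f := fun k => (x k - c k) ^ 2) (fun _ _ => sq_nonneg _)
        (Finset.mem_univ k)
    have h2 : 0 ≤ t * ∑ i, min (s i * eval x (g i)) 0 ^ 2 := by positivity
    have hx : P x ≤ P p := hx
    have h3 : P x = ∑ k, (x k - c k) ^ 2 + t * ∑ i, min (s i * eval x (g i)) 0 ^ 2 := rfl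
    linarith
  obtain ⟨q, hq⟩ := hPc.exists_forall_le_of_isBounded p hbdd
  set S : Finset κ := Finset.univ.filter fun i => s i * eval q (g i) ≤ 0 with hS
  have hmemS : ∀ i, i ∈ S ↔ s i * eval q (g i) ≤ 0 := fun i => by simp [hS]
  let Q : MvPolynomial ι ℝ := ∑ k, (X k - C (c k)) ^ 2 + C t * ∑ i ∈ S, g i ^ 2
  have hQ : ∀ x, eval x Q = ∑ k, (x k - c k) ^ 2 + t * ∑ i ∈ S, eval x (g i) ^ 2 := by
    intro x
    simp [Q]
  have hQq : eval q Q = P q := by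
    rw [hQ]
    simp only [P, hS, Finset.sum_filter]
    congr 2
    refine Finset.sum_congr rfl fun i _ => ?_
    split_ifs with h
    · rw [min_eq_left h, mul_pow, hs, one_mul]
    · rw [min_eq_right (not_le.1 h).le]; simp
  have hmin : IsLocalMin (fun x => eval x Q) q := by
    have hev : ∀ᶠ x in nhds q, ∀ i, i ∉ S → 0 < s i * eval x (g i) := by
      rw [Filter.eventually_all]
      intro i
      by_cases hi : i ∈ S
      · simp [hi]
      · have hpos : 0 < s i * eval q (g i) := by
          rw [hmemS] at hi
          exact not_le.1 hi
        have hcont : Continuous fun x => s i * eval x (g i) :=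
          continuous_const.mul (MvPolynomial.continuous_eval (g i))
        filter_upwards [hcont.continuousAt.eventually (lt_mem_nhds hpos)] with x hx _ using hx
    filter_upwards [hev] with x hx
    rw [hQq]
    refine (hq x).trans ?_
    rw [hQ]
    simp only [P]
    gcongr
    rw [← Finset.sum_subset (Finset.subset_univ S)]
    · refine Finset.sum_le_sum fun i _ => ?_
      rw [← one_mul (eval x (g i) ^ 2), ← hs i, ← mul_pow]
      rcases le_total (s i * eval x (g i)) 0 with h | h
      · rw [min_eq_left h]
      · rw [min_eq_right h, zero_pow two_ne_zero]; positivity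
    · intro i _ hi
      rw [min_eq_right (hx i hi).le]; simp
  have hgrad := hmin.hasFDerivAt_eq_zero (hasFDerivAt_eval_mvPolynomial Q q)
  refine ⟨q, S, hmemS, ?_, fun k => ?_⟩
  · rw [← hQ, hQq, ← hPp]
    exact hq p
  · have h := congrArg (fun L : (ι → ℝ) →L[ℝ] ℝ => L (Pi.single k 1)) hgrad
    simp [Q, Pi.single_apply, pderiv_X, Derivation.leibniz_pow, apply_ite, Finset.mul_sum] at h
    simp [Finset.mul_sum]
    have h2 : ∑ i ∈ S, t * (2 * (eval q (g i) * eval q (pderiv k (g i)))) =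
        2 * ∑ i ∈ S, t * (eval q (g i) * eval q (pderiv k (g i))) := by
      rw [Finset.mul_sum]
      exact Finset.sum_congr rfl fun i _ => by ring
    linarith

theorem exists_penalty_weight {ι κ : Type*} [Fintype ι] [Fintype κ]
    {g : κ → MvPolynomial ι ℝ}
    (hg : ∀ S : Finset κ, Fintype.card ι < S.card → ∀ x, ∃ i ∈ S, eval x (g i) ≠ 0)
    {K : Set (ι → ℝ)} (hK : IsCompact K) {B : ℝ} (hB : 0 ≤ B) :
    ∃ t : ℝ, 0 ≤ t ∧ ∀ S : Finset κ, Fintype.card ι < S.card → ∀ x ∈ K,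
      B < t * ∑ i ∈ S, eval x (g i) ^ 2 := by
  have h : ∀ S : Finset κ, ∃ η : ℝ, 0 < η ∧ (Fintype.card ι < S.card → ∀ x ∈ K,
      η ≤ ∑ i ∈ S, eval x (g i) ^ 2) := by
    intro S
    by_cases hS : Fintype.card ι < S.card
    · have hc : Continuous fun x => ∑ i ∈ S, eval x (g i) ^ 2 :=
        continuous_finsetSum _ fun i _ => (MvPolynomial.continuous_eval (g i)).pow 2
      rcases K.eq_empty_or_nonempty with rfl | hne
      · exact ⟨1, one_pos, by simp⟩
      · obtain ⟨x, -, hx⟩ := hK.exists_isMinOn hne hc.continuousOn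
        refine ⟨_, ?_, fun _ y hy => hx hy⟩
        obtain ⟨i, hi, hne⟩ := hg S hS x
        exact Finset.sum_pos' (fun _ _ => sq_nonneg _) ⟨i, hi, by positivity⟩
    · exact ⟨1, one_pos, fun h => absurd h hS⟩
  choose η hη hη' using h
  have hnn : ∀ S, 0 ≤ B / η S := fun S => div_nonneg hB (hη S).le
  refine ⟨1 + ∑ S, B / η S, add_nonneg zero_le_one (Finset.sum_nonneg fun S _ => hnn S),
    fun S hS x hx => ?_⟩
  have h1 : B / η S ≤ ∑ S, B / η S :=
    Finset.single_le_sum (f := fun S => B / η S) (fun S _ => hnn S) (Finset.mem_univ S)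
  calc B = B / η S * η S := by rw [div_mul_cancel₀ _ (hη S).ne']
    _ < (1 + ∑ S, B / η S) * η S := mul_lt_mul_of_pos_right (by linarith) (hη S)
    _ ≤ _ := mul_le_mul_of_nonneg_left (hη' S hS x hx) (by linarith [hnn S])

theorem card_signPatterns_le_of_no_common_zero {ι κ : Type*} [Fintype ι] [Fintype κ]
    {g : κ → MvPolynomial ι ℝ} {k : ℕ} (hdeg : ∀ i, (g i).totalDegree ≤ k + 1)
    (hg : ∀ S : Finset κ, Fintype.card ι < S.card → ∀ x, ∃ i ∈ S, eval x (g i) ≠ 0)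
    {A : Finset (κ → Bool)}
    (hA : ∀ F ∈ A, ∃ x, ∀ i, 0 < (if F i then (1 : ℝ) else -1) * eval x (g i)) :
    A.card ≤ ∑ S : Finset κ with S.card ≤ Fintype.card ι,
      2 ^ S.card * (2 * (k + 1)) ^ Fintype.card ι := by
  classical
  have hA' : ∀ F : κ → Bool, ∃ x : ι → ℝ, F ∈ A →
      ∀ i, 0 < (if F i then (1 : ℝ) else -1) * eval x (g i) := by
    intro F
    by_cases h : F ∈ A
    · obtain ⟨x, hx⟩ := hA F h
      exact ⟨x, fun _ => hx⟩
    · exact ⟨0, fun h' => absurd h' h⟩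
  choose p hp using hA'
  set B : ℝ := ∑ F, ∑ j, (|p F j| + 1) ^ 2 with hBdef
  have hB : 0 ≤ B := by positivity
  have hpB : ∀ c : ι → ℝ, ‖c‖ ≤ 1 → ∀ F, ∑ j, (p F j - c j) ^ 2 ≤ B := by
    intro c hc F
    refine le_trans (Finset.sum_le_sum fun j _ => ?_) (Finset.single_le_sum
      (f := fun F => ∑ j, (|p F j| + 1) ^ 2) (fun _ _ => by positivity) (Finset.mem_univ F))
    rw [← sq_abs (p F j - c j)]
    have hcj : |c j| ≤ 1 := (norm_le_pi_norm c j).trans hc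
    have := abs_sub (p F j) (c j)
    gcongr
    linarith
  obtain ⟨t, ht, htK⟩ := exists_penalty_weight hg
    (isCompact_closedBall (0 : ι → ℝ) (√B + 1)) hB
  obtain ⟨c, hc, hreg⟩ := exists_common_regular_value fun (S : Finset κ) (j : ι) =>
    X j + C t * ∑ i ∈ S, g i * pderiv j (g i)
  have hcrit := fun F : {F // F ∈ A} => exists_penalized_critical_point g
    (s := fun i => if F.1 i then (1 : ℝ) else -1) (fun i => by split_ifs <;> norm_num)
    (hp F.1 F.2) c ht
  choose q S hS hle hq using hcrit
  have hScard : ∀ F, (S F).card ≤ Fintype.card ι := by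
    intro F
    by_contra! hlt
    have hqF := (hle F).trans (hpB c hc F.1)
    have h1 : 0 ≤ t * ∑ i ∈ S F, eval (q F) (g i) ^ 2 := by positivity
    refine absurd (htK (S F) hlt (q F) ?_) (not_lt.2 ?_)
    · rw [mem_closedBall_zero_iff]
      have h2 : ‖q F - c‖ ≤ √B := by
        rw [pi_norm_le_iff_of_nonneg (Real.sqrt_nonneg _)]
        intro j
        refine Real.abs_le_sqrt ?_
        have := Finset.single_le_sum (f := fun j => (q F j - c j) ^ 2)
          (fun _ _ => sq_nonneg _) (Finset.mem_univ j)
        simp only [Pi.sub_apply]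
        linarith
      have h3 := norm_add_le (q F - c) c
      rw [sub_add_cancel] at h3
      linarith
    · have : 0 ≤ ∑ j, (q F j - c j) ^ 2 := by positivity
      linarith
  have hpattern : ∀ F F' : {F // F ∈ A}, S F = S F' → q F = q F' →
      (∀ i ∈ S F, F.1 i = F'.1 i) → F = F' := by
    intro F F' h1 h2 h3
    ext i
    by_cases hi : i ∈ S F
    · rw [h3 i hi]
    · have hi' := hi
      rw [h1] at hi'
      rw [hS, not_le] at hi hi'
      rw [h2] at hi
      cases hF : F.1 i <;> cases hF' : F'.1 i <;> simp_all <;> linarith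
  rw [← Finset.card_attach, Finset.card_eq_sum_card_fiberwise (f := S)
    (t := Finset.univ.filter fun S : Finset κ => S.card ≤ Fintype.card ι)
    (fun F _ => by simpa using hScard F)]
  refine Finset.sum_le_sum fun S₀ _ => ?_
  set fib := A.attach.filter fun F => S F = S₀ with hfib
  have hmem : ∀ F ∈ fib, S F = S₀ := fun F hF => (Finset.mem_filter.1 hF).2
  refine (Finset.card_le_mul_card_image (f := q) fib (2 ^ S₀.card) fun z _ => ?_).trans
    (Nat.mul_le_mul_left _ ?_)
  · calc _ ≤ Fintype.card (S₀ → Bool) := by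
          refine Finset.card_le_card_of_injOn (t := Finset.univ) (fun F i => F.1 i) (by simp) ?_
          intro F hF F' hF' h
          simp only [Finset.coe_filter, Set.mem_ofPred_eq] at hF hF'
          refine hpattern F F' ((hmem F hF.1).trans (hmem F' hF'.1).symm)
            (hF.2.trans hF'.2.symm) fun i hi => ?_
          exact congrFun h ⟨i, hmem F hF.1 ▸ hi⟩
      _ = _ := by simp
  · have hpd : ∀ i j, pderiv j (X i + C t * ∑ l ∈ S₀, g l * pderiv i (g l) - C (c i)) =
        pderiv j (X i + C t * ∑ l ∈ S₀, g l * pderiv i (g l)) := by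
      intro i j
      rw [map_sub, pderiv_C, sub_zero]
    have hz : ∀ z ∈ fib.image q, ∀ i,
        eval z (X i + C t * ∑ l ∈ S₀, g l * pderiv i (g l)) = c i := by
      intro z hz i
      obtain ⟨F, hF, rfl⟩ := Finset.mem_image.1 hz
      rw [← hmem F hF]
      exact hq F i
    have := card_nondegenerate_zeros_le (e := 2 * k + 1)
      (Ψ := fun i => X i + C t * ∑ l ∈ S₀, g l * pderiv i (g l) - C (c i)) (Z := fib.image q)
      (fun i => ?_) (fun z hz' i => by rw [map_sub, hz z hz' i, eval_C, sub_self])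
      (fun z hz' => by simp only [hpd]; exact hreg S₀ z (hz z hz'))
    · exact this
    · refine (totalDegree_sub_C_le _ _).trans ((totalDegree_add _ _).trans (max_le ?_ ?_))
      · rw [totalDegree_X]; omega
      · refine (totalDegree_mul _ _).trans ?_
        rw [totalDegree_C, zero_add]
        refine totalDegree_finsetSum_le fun l _ => (totalDegree_mul _ _).trans ?_
        have := hdeg l
        have := totalDegree_pderiv_le (hdeg l) i
        omega

theorem sum_two_pow_card_mul_le (κ : Type*) [Fintype κ] {n : ℕ} (D : ℕ) (hn : 0 < n)
    (hnκ : n ≤ Fintype.card κ) :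
    ((∑ S : Finset κ with S.card ≤ n, 2 ^ S.card * (2 * D) ^ n : ℕ) : ℝ) ≤
      (4 * Real.exp 1 * D * Fintype.card κ / n) ^ n := by
  have hn' : (0 : ℝ) < n := by exact_mod_cast hn
  have hN : (0 : ℝ) < Fintype.card κ := by exact_mod_cast hn.trans_le hnκ
  set y : ℝ := n / Fintype.card κ with hy
  have hy0 : 0 < y := div_pos hn' hN
  have hy1 : y ≤ 1 := (div_le_one hN).2 (by exact_mod_cast hnκ)
  have hcount : y ^ n * ∑ S : Finset κ with S.card ≤ n, (1 : ℝ) ≤ Real.exp 1 ^ n := by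
    calc y ^ n * ∑ S : Finset κ with S.card ≤ n, (1 : ℝ)
        ≤ ∑ S : Finset κ with S.card ≤ n, y ^ S.card := by
          rw [Finset.mul_sum]
          refine Finset.sum_le_sum fun S hS => ?_
          rw [mul_one]
          exact pow_le_pow_of_le_one hy0.le hy1 (Finset.mem_filter.1 hS).2
      _ ≤ ∑ S : Finset κ, y ^ S.card :=
          Finset.sum_le_sum_of_subset_of_nonneg (Finset.filter_subset _ _)
            fun _ _ _ => by positivity
      _ = (y + 1) ^ Fintype.card κ := by
          simpa using Fintype.sum_pow_mul_eq_add_pow κ y 1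
      _ ≤ Real.exp y ^ Fintype.card κ := by gcongr; exact Real.add_one_le_exp y
      _ = Real.exp 1 ^ n := by
          rw [← Real.exp_nat_mul, ← Real.exp_nat_mul, hy]
          congr 1
          field_simp
  have hsum : ((∑ S : Finset κ with S.card ≤ n, 2 ^ S.card * (2 * D) ^ n : ℕ) : ℝ) ≤
      (2 * (2 * D)) ^ n * ∑ S : Finset κ with S.card ≤ n, (1 : ℝ) := by
    push_cast
    rw [Finset.mul_sum]
    refine Finset.sum_le_sum fun S hS => ?_
    rw [mul_one, mul_pow 2 (2 * (D : ℝ))]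
    gcongr
    · norm_num
    · exact (Finset.mem_filter.1 hS).2
  refine hsum.trans ?_
  have heq : (4 * Real.exp 1 * D * Fintype.card κ / n) ^ n =
      (2 * (2 * D)) ^ n * (Real.exp 1 ^ n / y ^ n) := by
    rw [← div_pow, ← mul_pow, hy]
    congr 1
    field_simp
    ring
  rw [heq]
  gcongr
  rwa [le_div_iff₀' (by positivity)]

/-- **Warren's theorem**: the number of strict sign patterns attained by `N` real polynomials of
degree at most `D ≥ 1` in `n ≤ N` variables is at most `(4 e D N / n) ^ n`. -/
theorem card_signPatterns_le {ι κ : Type*} [Fintype ι] [Fintype κ] [Nonempty ι]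
    (hικ : Fintype.card ι ≤ Fintype.card κ) {f : κ → MvPolynomial ι ℝ} {D : ℕ} (hD : 0 < D)
    (hdeg : ∀ i, (f i).totalDegree ≤ D) {A : Finset (κ → Bool)}
    (hA : ∀ F ∈ A, ∃ x, ∀ i, 0 < (if F i then (1 : ℝ) else -1) * eval x (f i)) :
    (A.card : ℝ) ≤
      (4 * Real.exp 1 * D * Fintype.card κ / Fintype.card ι) ^ Fintype.card ι := by
  choose! p hp using hA
  let U : Set (κ → ℝ) := {b | ∀ F ∈ A, ∀ i,
    0 < (if F i then (1 : ℝ) else -1) * (eval (p F) (f i) - b i)}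
  have hU : IsOpen U := by
    have : U = ⋂ F ∈ A, ⋂ i, {b : κ → ℝ |
        0 < (if F i then (1 : ℝ) else -1) * (eval (p F) (f i) - b i)} := by
      ext b; simp [U]
    rw [this]
    exact isOpen_biInter_finset fun F _ => isOpen_iInter_of_finite fun i =>
      isOpen_lt continuous_const (by fun_prop)
  obtain ⟨b, hbU, hb⟩ := (dense_setOf_no_common_zero f).inter_open_nonempty U hU
    ⟨0, fun F hF i => by simpa using hp F hF i⟩
  obtain ⟨k, rfl⟩ := Nat.exists_eq_succ_of_ne_zero hD.ne'
  have h := card_signPatterns_le_of_no_common_zero (g := fun i => f i - C (b i)) (k := k)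
    (fun i => (totalDegree_sub_C_le _ _).trans (hdeg i))
    (fun S hS x => by simpa [sub_ne_zero] using hb S hS x) (A := A)
    (fun F hF => ⟨p F, fun i => by simpa using hbU F hF i⟩)
  exact (Nat.cast_le.2 h).trans (sum_two_pow_card_mul_le κ (k + 1) Fintype.card_pos hικ)

theorem Matrix.exists_eq_mul_of_rank_le {m n : Type*} [Fintype m] [Fintype n] {d : ℕ}
    {M : Matrix m n ℝ} (h : M.rank ≤ d) :
    ∃ (A : Matrix m (Fin d) ℝ) (B : Matrix (Fin d) n ℝ), M = A * B := by
  classical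
  obtain ⟨φ, hφ⟩ : ∃ φ : (Fin d → ℝ) →ₗ[ℝ] LinearMap.range M.mulVecLin,
      Function.Surjective φ := by
    have b := Module.finBasis ℝ (LinearMap.range M.mulVecLin)
    have hd : Module.finrank ℝ (LinearMap.range M.mulVecLin) ≤ d := h
    refine ⟨b.equivFun.symm.toLinearMap ∘ₗ LinearMap.funLeft ℝ ℝ (Fin.castLE hd), ?_⟩
    exact b.equivFun.symm.surjective.comp
      (LinearMap.funLeft_surjective_of_injective ℝ ℝ _ (Fin.castLE_injective hd))
  choose ψ hψ using hφ
  let A := LinearMap.toMatrix' ((LinearMap.range M.mulVecLin).subtype ∘ₗ φ)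
  refine ⟨A, Matrix.of fun k j => ψ ⟨M.mulVecLin (Pi.single j 1), ⟨_, rfl⟩⟩ k, ?_⟩
  ext i j
  have h1 : A.mulVec (ψ ⟨M.mulVecLin (Pi.single j 1), ⟨_, rfl⟩⟩) =
      M.mulVecLin (Pi.single j 1) := by
    rw [LinearMap.toMatrix'_mulVec]
    simp [hψ]
  have h2 : M.mulVecLin (Pi.single j 1) i = M i j := by simp
  rw [← h2, ← h1]
  rfl

theorem exists_rank_le_of_signRank_le {X Y : Type*} [Fintype X] [Fintype Y] {F : Matrix X Y ℝ}
    (hF : ∀ x y, F x y ≠ 0) {d : ℕ} (h : signRank F ≤ d) :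
    ∃ M : Matrix X Y ℝ, (∀ x y, 0 < F x y * M x y) ∧ M.rank ≤ d := by
  obtain ⟨M, hM, hr⟩ := Nat.sInf_mem (s := {r : ℕ | ∃ M : Matrix X Y ℝ,
    (∀ x y, 0 < F x y * M x y) ∧ M.rank ≤ r})
    ⟨F.rank, F, fun x y => mul_self_pos.2 (hF x y), le_rfl⟩
  exact ⟨M, hM, hr.trans h⟩

end

/-- There is an absolute constant `C > 0` such that for all `m ≥ 2` and `1 ≤ d ≤ m/2`,
the number of `m × m` sign matrices of sign-rank at most `d` is at most `(C·m/d)^{2dm}`.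
(Sign matrices are encoded by Boolean matrices via `true ↦ 1`, `false ↦ -1`.) -/
theorem count_signRank_le :
    ∃ C : ℝ, 0 < C ∧ ∀ m d : ℕ, 2 ≤ m → 1 ≤ d → 2 * d ≤ m →
      (Nat.card {F : Matrix (Fin m) (Fin m) Bool //
          signRank (Matrix.of fun x y => if F x y then (1 : ℝ) else -1) ≤ d} : ℝ) ≤
        (C * m / d) ^ (2 * d * m) := by
  refine ⟨4 * Real.exp 1, by positivity, fun m d hm hd hdm => ?_⟩
  let f : Fin m × Fin m → MvPolynomial (Fin m × Fin d ⊕ Fin d × Fin m) ℝ := fun p =>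
    ∑ k, MvPolynomial.X (Sum.inl (p.1, k)) * MvPolynomial.X (Sum.inr (k, p.2))
  let A : Finset (Fin m × Fin m → Bool) := Finset.univ.filter fun F =>
    signRank (Matrix.of fun x y => if F (x, y) then (1 : ℝ) else -1) ≤ d
  have hcard : Nat.card {F : Matrix (Fin m) (Fin m) Bool //
      signRank (Matrix.of fun x y => if F x y then (1 : ℝ) else -1) ≤ d} = A.card := by
    rw [← Fintype.card_coe, ← Nat.card_eq_fintype_card]
    exact Nat.card_congr ((Equiv.curry _ _ _).symm.subtypeEquiv fun F =>
      ⟨fun h => Finset.mem_filter.2 ⟨Finset.mem_univ _, h⟩, fun h => (Finset.mem_filter.1 h).2⟩)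
  have : Nonempty (Fin m × Fin d ⊕ Fin d × Fin m) := ⟨Sum.inl (⟨0, by omega⟩, ⟨0, by omega⟩)⟩
  have hι : Fintype.card (Fin m × Fin d ⊕ Fin d × Fin m) = 2 * d * m := by
    simp only [Fintype.card_sum, Fintype.card_prod, Fintype.card_fin]
    ring
  have hκ : Fintype.card (Fin m × Fin m) = m * m := by simp
  have hdeg : ∀ p, (f p).totalDegree ≤ 2 := fun p =>
    MvPolynomial.totalDegree_finsetSum_le fun k _ =>
      (MvPolynomial.totalDegree_mul _ _).trans (by simp)
  have hA : ∀ F ∈ A, ∃ x, ∀ p, 0 < (if F p then (1 : ℝ) else -1) * MvPolynomial.eval x (f p) := by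
    intro F hF
    obtain ⟨M, hM, hr⟩ := exists_rank_le_of_signRank_le
      (fun x y => by rw [Matrix.of_apply]; split_ifs <;> norm_num) (Finset.mem_filter.1 hF).2
    obtain ⟨U, V, rfl⟩ := Matrix.exists_eq_mul_of_rank_le hr
    refine ⟨Sum.elim (fun q => U q.1 q.2) fun q => V q.1 q.2, fun p => ?_⟩
    simpa [f, Matrix.mul_apply] using hM p.1 p.2
  have h := card_signPatterns_le (by rw [hι, hκ]; exact Nat.mul_le_mul_right m hdm)
    two_pos hdeg hA
  rw [hι, hκ] at h
  rw [hcard]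
  refine h.trans_eq ?_
  have hm' : (m : ℝ) ≠ 0 := by exact_mod_cast (by omega : m ≠ 0)
  have hd' : (d : ℝ) ≠ 0 := by exact_mod_cast (by omega : d ≠ 0)
  congr 1
  push_cast
  field_simp
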